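/- arXiv:1008.3560 — 2 statements merged into one kernel-verified Lean document; each statement's English description precedes it below -/
import Mathlib

section
/- In the Tracy–Widom setting, fix indices j ≠ l and suppose equations (TW1) (for the pair j, l in both orders), (TW2), and (TW3) hold, with q's, p's C¹ and u, v, w, T C². Then with F = −uw and G_j = u ∂_j w − w ∂_j u, at every point of Ω: ∂_j F · ∂_l F − G_j G_l + 4 F ∂_j v ∂_l v = 2 F (a_j − a_l)² ∂_j∂_l T. -/
noncomputable section

/-- Partial derivative in the `j`-th coordinate direction. -/
def pd {N : ℕ} (j : Fin N) (f : (Fin N → ℝ) → ℝ) : (Fin N → ℝ) → ℝ :=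
  fun x => fderiv ℝ f x (Pi.single j 1)

/-- Virasoro-type operator `𝓑_k` (meaningful for `k ≥ -1`):
`𝓑_k f = Σ_j a_j^(k+1) ∂_j f`. -/
def Bop {N : ℕ} (k : ℤ) (f : (Fin N → ℝ) → ℝ) : (Fin N → ℝ) → ℝ :=
  fun x => ∑ j, (x j) ^ (k + 1).toNat * pd j f x

/-- `𝓓 = 𝓑_{-1} = Σ_j ∂_j`. -/
def Dop {N : ℕ} (f : (Fin N → ℝ) → ℝ) : (Fin N → ℝ) → ℝ := Bop (-1) f

/-- `Ĝ_k = Σ_j a_j^k G_j` (meaningful for `k ≥ 0`). -/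
def hatG {N : ℕ} (k : ℤ) (G : Fin N → (Fin N → ℝ) → ℝ) : (Fin N → ℝ) → ℝ :=
  fun x => ∑ j, (x j) ^ k.toNat * G j x

/-- The Tracy–Widom resolvent quantity `R_{jk} = (q_j p_k - p_j q_k)/(a_j - a_k)`. -/
def Rjk {N : ℕ} (q p : Fin N → (Fin N → ℝ) → ℝ) (j k : Fin N) : (Fin N → ℝ) → ℝ :=
  fun x => (q j x * p k x - p j x * q k x) / (x j - x k)

theorem pd_line {N : ℕ} (j : Fin N) (f : (Fin N → ℝ) → ℝ) (x c : Fin N → ℝ) (s : ℝ)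
    (hf : DifferentiableAt ℝ f (x + s • (Pi.single j 1 : Fin N → ℝ) + c)) :
    HasDerivAt (fun t : ℝ => f (x + t • (Pi.single j 1 : Fin N → ℝ) + c))
      (pd j f (x + s • (Pi.single j 1 : Fin N → ℝ) + c)) s := by
  have h1 : HasDerivAt (fun t : ℝ => x + t • (Pi.single j 1 : Fin N → ℝ) + c)
      (Pi.single j 1 : Fin N → ℝ) s := by
    have := (((hasDerivAt_id s).smul_const (Pi.single j 1 : Fin N → ℝ)).const_add x).add_const c
    simpa using this
  exact hf.hasFDerivAt.comp_hasDerivAt s h1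

theorem pd_line0 {N : ℕ} (j : Fin N) (f : (Fin N → ℝ) → ℝ) (x : Fin N → ℝ) (s : ℝ)
    (hf : DifferentiableAt ℝ f (x + s • (Pi.single j 1 : Fin N → ℝ))) :
    HasDerivAt (fun t : ℝ => f (x + t • (Pi.single j 1 : Fin N → ℝ)))
      (pd j f (x + s • (Pi.single j 1 : Fin N → ℝ))) s := by
  have := pd_line j f x 0 s (by simpa using hf)
  simpa using this

open Filter Topology in
theorem pd_mixed {N : ℕ} (j l : Fin N) (f m : (Fin N → ℝ) → ℝ) (x : Fin N → ℝ)
    (m' : (Fin N → ℝ) →L[ℝ] ℝ)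
    (hf : ∀ᶠ y in 𝓝 x, DifferentiableAt ℝ f y) (hm : ∀ᶠ y in 𝓝 x, pd j f y = m y)
    (hs : HasStrictFDerivAt m m' x) :
    HasDerivAt (fun s : ℝ => pd l f (x + s • (Pi.single j 1 : Fin N → ℝ)))
      (m' (Pi.single l 1)) 0 := by
  set ej : Fin N → ℝ := Pi.single j 1 with hej
  set el : Fin N → ℝ := Pi.single l 1 with hel
  have c1 : Tendsto (fun z : ℝ × ℝ => x + z.2 • ej + z.1 • el) (𝓝[≠] 0 ×ˢ 𝓝 0) (𝓝 x) := by
    have h : Tendsto (fun z : ℝ × ℝ => x + z.2 • ej + z.1 • el) (𝓝 (0, 0)) (𝓝 x) := by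
      have : Continuous (fun z : ℝ × ℝ => x + z.2 • ej + z.1 • el) := by fun_prop
      simpa using this.tendsto (0, 0)
    refine h.mono_left ?_
    rw [nhds_prod_eq]
    exact prod_mono nhdsWithin_le_nhds le_rfl
  have c0' : Tendsto (fun s : ℝ => x + s • ej) (𝓝 0) (𝓝 x) := by
    have : Continuous (fun s : ℝ => x + s • ej) := by fun_prop
    simpa using this.tendsto 0
  have c0 : Tendsto (fun z : ℝ × ℝ => x + z.2 • ej) (𝓝[≠] 0 ×ˢ 𝓝 0) (𝓝 x) :=
    c0'.comp tendsto_snd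
  have ne : ∀ᶠ z : ℝ × ℝ in 𝓝[≠] 0 ×ˢ 𝓝 0, z.1 ≠ 0 :=
    tendsto_fst.eventually (eventually_mem_nhdsWithin (a := (0 : ℝ)) (s := {0}ᶜ))
  refine hasDerivAt_of_tendstoUniformlyOnFilter (l := 𝓝[≠] (0 : ℝ))
    (f := fun t s => t⁻¹ * (f (x + s • ej + t • el) - f (x + s • ej)))
    (f' := fun t s => t⁻¹ * (m (x + s • ej + t • el) - m (x + s • ej)))
    (g' := fun _ => m' el) ?_ ?_ ?_
  · rw [tendstoUniformlyOnFilter_iff_tendsto, Metric.uniformity_eq_comap_nhds_zero,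
      tendsto_comap_iff]
    have h2 := (hs.isLittleO.comp_tendsto (c1.prodMk_nhds c0))
    rw [Metric.tendsto_nhds]
    intro ε hε
    have h3 := h2.def (c := ε / (‖el‖ + 1)) (by positivity)
    filter_upwards [h3, ne] with z hz hz0
    simp only [Function.comp, add_sub_cancel_left, map_smul, norm_smul, smul_eq_mul] at hz
    have e : m' el - z.1⁻¹ * (m (x + z.2 • ej + z.1 • el) - m (x + z.2 • ej)) =
      - (z.1⁻¹ * (m (x + z.2 • ej + z.1 • el) - m (x + z.2 • ej) - z.1 * m' el)) := by
      field_simp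
      ring
    simp only [Function.comp, Real.dist_eq, sub_zero, abs_abs]
    rw [e, abs_neg, abs_mul, abs_inv]
    have hp : 0 < |z.1| := abs_pos.2 hz0
    rw [inv_mul_lt_iff₀ hp]
    simp only [Real.norm_eq_abs] at hz
    refine hz.trans_lt ?_
    have : ε / (‖el‖ + 1) * (|z.1| * ‖el‖) = |z.1| * ε * (‖el‖ / (‖el‖ + 1)) := by ring
    rw [this]
    have h4 : ‖el‖ / (‖el‖ + 1) < 1 := by
      rw [div_lt_one (by positivity)]; linarith
    have : 0 < |z.1| * ε := by positivity
    nlinarith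
  · filter_upwards [c1.eventually hf, c0.eventually hf, c1.eventually hm, c0.eventually hm]
      with z a1 a2 a3 a4
    rw [← a3, ← a4]
    exact ((pd_line j f x _ z.2 a1).sub (pd_line0 j f x z.2 a2)).const_mul _
  · filter_upwards [c0'.eventually hf] with s h
    have := pd_line0 l f (x + s • ej) 0 (by simpa using h)
    rw [hasDerivAt_iff_tendsto_slope] at this
    simpa [slope_fun_def] using this

open Filter Topology in
theorem statement2 {N : ℕ} (hN : 2 ≤ N) (Ω : Set (Fin N → ℝ)) (hΩ : IsOpen Ω)
    (hdist : ∀ x ∈ Ω, ∀ j l : Fin N, j ≠ l → x j ≠ x l)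
    (u v w T : (Fin N → ℝ) → ℝ) (q p : Fin N → (Fin N → ℝ) → ℝ)
    (j l : Fin N) (hjl : j ≠ l)
    (hq : ∀ i, ContDiffOn ℝ 1 (q i) Ω) (hp : ∀ i, ContDiffOn ℝ 1 (p i) Ω)
    (hu : ContDiffOn ℝ 2 u Ω) (hv : ContDiffOn ℝ 2 v Ω)
    (hw : ContDiffOn ℝ 2 w Ω) (hT : ContDiffOn ℝ 2 T Ω)
    (hTW1a : ∀ x ∈ Ω, pd l (q j) x = (-1 : ℝ) ^ (l : ℕ) * Rjk q p j l x * q l x)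
    (hTW1b : ∀ x ∈ Ω, pd l (p j) x = (-1 : ℝ) ^ (l : ℕ) * Rjk q p j l x * p l x)
    (hTW1c : ∀ x ∈ Ω, pd j (q l) x = (-1 : ℝ) ^ (j : ℕ) * Rjk q p l j x * q j x)
    (hTW1d : ∀ x ∈ Ω, pd j (p l) x = (-1 : ℝ) ^ (j : ℕ) * Rjk q p l j x * p j x)
    (hTW2u : ∀ (i : Fin N), ∀ x ∈ Ω, pd i u x = (-1 : ℝ) ^ (i : ℕ) * (q i x) ^ 2)
    (hTW2v : ∀ (i : Fin N), ∀ x ∈ Ω, pd i v x = (-1 : ℝ) ^ (i : ℕ) * (q i x * p i x))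
    (hTW2w : ∀ (i : Fin N), ∀ x ∈ Ω, pd i w x = (-1 : ℝ) ^ (i : ℕ) * (p i x) ^ 2)
    (hTW3 : ∀ (i : Fin N), ∀ x ∈ Ω,
      (-1 : ℝ) ^ ((i : ℕ) + 1) * pd i T x = p i x * pd i (q i) x - q i x * pd i (p i) x)
    (F : (Fin N → ℝ) → ℝ) (hF : ∀ x, F x = -(u x * w x))
    (G : Fin N → (Fin N → ℝ) → ℝ)
    (hG : ∀ i x, G i x = u x * pd i w x - w x * pd i u x) :
    ∀ x ∈ Ω,
      pd j F x * pd l F x - G j x * G l x + 4 * F x * pd j v x * pd l v x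
        = 2 * F x * (x j - x l) ^ 2 * pd j (pd l T) x := by
  intro x hx
  have hnx : Ω ∈ 𝓝 x := hΩ.mem_nhds hx
  have hD : x l - x j ≠ 0 := sub_ne_zero.2 (hdist x hx l j hjl.symm)
  have hD' : x j - x l ≠ 0 := sub_ne_zero.2 (hdist x hx j l hjl)
  have dq : ∀ i, ∀ y ∈ Ω, DifferentiableAt ℝ (q i) y := fun i y hy =>
    ((hq i).contDiffAt (hΩ.mem_nhds hy)).differentiableAt (by norm_num)
  have dp : ∀ i, ∀ y ∈ Ω, DifferentiableAt ℝ (p i) y := fun i y hy =>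
    ((hp i).contDiffAt (hΩ.mem_nhds hy)).differentiableAt (by norm_num)
  have du : DifferentiableAt ℝ u x := (hu.contDiffAt hnx).differentiableAt (by norm_num)
  have dw : DifferentiableAt ℝ w x := (hw.contDiffAt hnx).differentiableAt (by norm_num)
  have cR : ContDiffAt ℝ 1 (Rjk q p l j) x := by
    unfold Rjk
    have a1 := (hq l).contDiffAt hnx
    have a2 := (hq j).contDiffAt hnx
    have a3 := (hp l).contDiffAt hnx
    have a4 := (hp j).contDiffAt hnx
    exact ((a1.mul a4).sub (a3.mul a2)).div
      ((contDiff_apply ℝ ℝ l).contDiffAt.sub (contDiff_apply ℝ ℝ j).contDiffAt) hD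
  have line : ∀ (i : Fin N) (f : (Fin N → ℝ) → ℝ), DifferentiableAt ℝ f x →
      HasDerivAt (fun t : ℝ => f (x + t • (Pi.single i 1 : Fin N → ℝ))) (pd i f x) 0 := by
    intro i f hf
    have := pd_line0 i f x 0 (by simpa using hf)
    simpa using this
  -- derivative of R
  have hRl : pd l (Rjk q p l j) x = ((pd l (q l) x * p j x + q l x * pd l (p j) x
      - (pd l (p l) x * q j x + p l x * pd l (q j) x)) * (x l - x j)
      - (q l x * p j x - p l x * q j x) * 1) / (x l - x j) ^ 2 := by
    have h1 := line l _ (cR.differentiableAt (by norm_num))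
    have hc : HasDerivAt (fun t : ℝ => (x + t • (Pi.single l 1 : Fin N → ℝ)) l
        - (x + t • (Pi.single l 1 : Fin N → ℝ)) j) 1 0 := by
      have : (fun t : ℝ => (x + t • (Pi.single l 1 : Fin N → ℝ)) l
        - (x + t • (Pi.single l 1 : Fin N → ℝ)) j) = fun t => t + (x l - x j) := by
        funext t
        simp [hjl]
        ring
      rw [this]
      exact (hasDerivAt_id _).add_const _
    have h2 := (((line l _ (dq l x hx)).mul (line l _ (dp j x hx))).sub
      ((line l _ (dp l x hx)).mul (line l _ (dq j x hx)))).div hc (by simpa using hD)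
    have := h1.unique h2
    simpa using this
  have key : ∀ (f g : (Fin N → ℝ) → ℝ), (∀ y ∈ Ω, DifferentiableAt ℝ f y) →
      ContDiffAt ℝ 1 g x →
      (∀ y ∈ Ω, pd j f y = (-1 : ℝ) ^ (j : ℕ) * Rjk q p l j y * g y) →
      HasDerivAt (fun s : ℝ => pd l f (x + s • (Pi.single j 1 : Fin N → ℝ)))
        ((-1 : ℝ) ^ (j : ℕ) * (pd l (Rjk q p l j) x * g x + Rjk q p l j x * pd l g x)) 0 := by
    intro f g hf hg hfg
    have hm : ContDiffAt ℝ 1 (fun y => (-1 : ℝ) ^ (j : ℕ) * Rjk q p l j y * g y) x :=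
      (contDiffAt_const.mul cR).mul hg
    have h := pd_mixed j l f _ x _ (by filter_upwards [hnx] with y hy using hf y hy)
      (by filter_upwards [hnx] with y hy using hfg y hy)
      (hm.hasStrictFDerivAt (by norm_num))
    convert h using 1
    have h1 := line l _ (hm.differentiableAt (by norm_num))
    have h2 := ((line l _ (cR.differentiableAt (by norm_num))).const_mul
      ((-1 : ℝ) ^ (j : ℕ))).mul (line l _ (hg.differentiableAt (by norm_num)))
    have h3 := h1.unique h2
    change _ = pd l _ x
    rw [h3]
    simp
    ring
  have kq := key (q l) (q j) (dq l) ((hq j).contDiffAt hnx) hTW1c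
  have kp := key (p l) (p j) (dp l) ((hp j).contDiffAt hnx) hTW1d
  have c0' : Tendsto (fun s : ℝ => x + s • (Pi.single j 1 : Fin N → ℝ)) (𝓝 0) (𝓝 x) := by
    have : Continuous (fun s : ℝ => x + s • (Pi.single j 1 : Fin N → ℝ)) := by fun_prop
    simpa using this.tendsto 0
  have sq1 : ∀ i : ℕ, ((-1 : ℝ) ^ i) ^ 2 = 1 := fun i => by
    rw [← pow_mul, mul_comm, pow_mul]; norm_num
  have hTl : ∀ y ∈ Ω, pd l T y = (-1 : ℝ) ^ ((l : ℕ) + 1) *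
      (p l y * pd l (q l) y - q l y * pd l (p l) y) := by
    intro y hy
    rw [← hTW3 l y hy, ← mul_assoc, ← sq, sq1, one_mul]
  have dT : DifferentiableAt ℝ (pd l T) x := by
    have h1 : ContDiffAt ℝ 1 (fderiv ℝ T) x :=
      (hT.contDiffAt hnx).fderiv_right (by norm_num)
    exact (h1.differentiableAt (by norm_num)).clm_apply (differentiableAt_const _)
  have t1 := line j _ dT
  have t2 := ((((line j _ (dp l x hx)).mul kq).sub
    ((line j _ (dq l x hx)).mul kp)).const_mul ((-1 : ℝ) ^ ((l : ℕ) + 1)))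
  have t3 := t1.unique (t2.congr_of_eventuallyEq (by
    filter_upwards [c0'.eventually hnx] with s hs
    exact hTl _ hs))
  simp only [zero_smul, add_zero] at t3
  have hFd : ∀ i, pd i F x = -(pd i u x * w x + u x * pd i w x) := by
    intro i
    have e : F = fun y => -(u y * w y) := funext hF
    have h1 := line i F (by rw [e]; exact (du.mul dw).neg)
    have h2 := ((line i _ du).mul (line i _ dw)).neg
    rw [e] at h1 ⊢
    have := h1.unique h2
    simpa using this
  have hT2 : pd j (pd l T) x = -((-1 : ℝ) ^ (l : ℕ) * (-1 : ℝ) ^ (j : ℕ)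
      * (Rjk q p l j x) ^ 2) := by
    rw [t3, hRl, hTW1c x hx, hTW1d x hx, hTW1a x hx, hTW1b x hx, pow_succ]
    generalize pd l (q l) x = Q
    generalize pd l (p l) x = P
    have e1 : Rjk q p j l x = Rjk q p l j x := by
      simp only [Rjk]
      field_simp
      ring
    rw [e1]
    have e2 : q l x * p j x = Rjk q p l j x * (x l - x j) + p l x * q j x := by
      simp only [Rjk]
      field_simp
      ring
    generalize Rjk q p l j x = R at *
    generalize x l - x j = D at *
    have e3 : D ≠ 0 := hD
    have e4 : R = (q l x * p j x - p l x * q j x) / D := by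
      rw [e2]; field_simp; ring
    rw [e4]
    field_simp
    ring
  rw [hT2, hFd, hFd, hG, hG, hF, hTW2u, hTW2u, hTW2v, hTW2v, hTW2w, hTW2w]
  any_goals exact hx
  simp only [Rjk]
  have : (x j - x l) ^ 2 = (x l - x j) ^ 2 := by ring
  rw [this]
  field_simp
  ring
end
end

section
/- (Theorem 3, linear series.) Let v : Ω → ℝ be C² and G_1,…,G_N : Ω → ℝ be C¹ functions such that for every pair j ≠ l one has ∂_j G_l − ∂_l G_j = 2 (a_j − a_l) ∂_j∂_l v. Then for all integers k, m ≥ 0, at every point of Ω: 𝓑_{k−1}Ĝ_m − 𝓑_{m−1}Ĝ_k + (k − m) Ĝ_{k+m−1} = 2 (𝓑_k 𝓑_{m−1} − 𝓑_{k−1} 𝓑_m + 𝓑_{k+m−1}) v. -/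
noncomputable section

theorem pd_sum_aux {N : ℕ} (F : Fin N → (Fin N → ℝ) → ℝ) (x : Fin N → ℝ)
    (hF : ∀ l, DifferentiableAt ℝ (F l) x) (m : ℕ) (j : Fin N) :
    pd j (fun y => ∑ l, (y l) ^ m * F l y) x
      = ∑ l, (x l) ^ m * pd j (F l) x + (m : ℝ) * (x j) ^ (m - 1) * F j x := by
  have h1 : ∀ l : Fin N, HasFDerivAt (fun y : Fin N → ℝ => y l)
      (ContinuousLinearMap.proj (R := ℝ) (φ := fun _ : Fin N => ℝ) l) x :=
    fun l => hasFDerivAt_apply l x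
  have h2 := HasFDerivAt.fun_sum (u := Finset.univ)
    (fun l _ => ((h1 l).pow m).mul (hF l).hasFDerivAt)
  unfold pd
  have h3 : fderiv ℝ (fun y => ∑ l, (y l) ^ m * F l y) x = _ := h2.fderiv
  rw [h3]
  simp [Finset.sum_add_distrib, Pi.single_apply]
  ring

theorem B_sum_aux {N : ℕ} (F : Fin N → (Fin N → ℝ) → ℝ) (x : Fin N → ℝ)
    (hF : ∀ l, DifferentiableAt ℝ (F l) x) (k m : ℕ) :
    ∑ j, (x j) ^ k * pd j (fun y => ∑ l, (y l) ^ m * F l y) x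
      = ∑ j, ∑ l, (x j) ^ k * (x l) ^ m * pd j (F l) x
        + (m : ℝ) * ∑ j, (x j) ^ (k + m - 1) * F j x := by
  rw [Finset.mul_sum, ← Finset.sum_add_distrib]
  refine Finset.sum_congr rfl fun j _ => ?_
  rw [pd_sum_aux F x hF, mul_add, Finset.mul_sum]
  congr 1
  · exact Finset.sum_congr rfl fun l _ => by ring
  · rcases m with _ | m
    · simp
    · have : k + (m + 1) - 1 = k + m := by omega
      rw [this, Nat.add_sub_cancel, pow_add]
      ring

theorem statement11 {N : ℕ} (hN : 2 ≤ N) (Ω : Set (Fin N → ℝ)) (hΩ : IsOpen Ω)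
    (hdist : ∀ x ∈ Ω, ∀ j l : Fin N, j ≠ l → x j ≠ x l)
    (v : (Fin N → ℝ) → ℝ) (G : Fin N → (Fin N → ℝ) → ℝ)
    (hv : ContDiffOn ℝ 2 v Ω) (hG : ∀ j, ContDiffOn ℝ 1 (G j) Ω)
    (h : ∀ (j l : Fin N), j ≠ l → ∀ x ∈ Ω,
      pd j (G l) x - pd l (G j) x = 2 * (x j - x l) * pd j (pd l v) x) :
    ∀ (k m : ℕ), ∀ x ∈ Ω,
      Bop ((k : ℤ) - 1) (hatG (m : ℤ) G) x - Bop ((m : ℤ) - 1) (hatG (k : ℤ) G) x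
          + ((k : ℝ) - (m : ℝ)) * hatG ((k : ℤ) + (m : ℤ) - 1) G x
        = 2 * (Bop (k : ℤ) (Bop ((m : ℤ) - 1) v) x
            - Bop ((k : ℤ) - 1) (Bop (m : ℤ) v) x
            + Bop ((k : ℤ) + (m : ℤ) - 1) v x) := by
  intro k m x hx
  have hGd : ∀ l, DifferentiableAt ℝ (G l) x := fun l =>
    ((hG l).contDiffAt (hΩ.mem_nhds hx)).differentiableAt (by norm_num)
  have hvd : ∀ l, DifferentiableAt ℝ (pd l v) x := by
    intro l
    have h1 : DifferentiableAt ℝ (fderiv ℝ v) x :=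
      ((hv.contDiffAt (hΩ.mem_nhds hx)).fderiv_right (m := 1) (by norm_num)).differentiableAt
        (by norm_num)
    exact h1.clm_apply (differentiableAt_const _)
  have e1 : ∀ n : ℕ, ((n : ℤ) - 1 + 1).toNat = n := by intro n; omega
  have e2 : ∀ n : ℕ, ((n : ℤ) + 1).toNat = n + 1 := by intro n; omega
  have e3 : ((k : ℤ) + m - 1).toNat = k + m - 1 := by omega
  have e4 : ((k : ℤ) + m - 1 + 1).toNat = k + m := by omega
  have e5 : k + 1 + m - 1 = k + m := by omega
  have e6 : k + (m + 1) - 1 = k + m := by omega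
  have e7 : m + k - 1 = k + m - 1 := by omega
  unfold Bop hatG
  simp only [e1, e2, e3, e4, Int.toNat_natCast]
  rw [B_sum_aux G x hGd, B_sum_aux G x hGd, B_sum_aux (fun l => pd l v) x hvd,
    B_sum_aux (fun l => pd l v) x hvd, e5, e6, e7]
  have key : ∑ j, ∑ l, (x j) ^ k * (x l) ^ m * pd j (G l) x
      - ∑ j, ∑ l, (x j) ^ m * (x l) ^ k * pd j (G l) x
      = 2 * (∑ j, ∑ l, (x j) ^ (k + 1) * (x l) ^ m * pd j (pd l v) x
        - ∑ j, ∑ l, (x j) ^ k * (x l) ^ (m + 1) * pd j (pd l v) x) := by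
    rw [Finset.sum_comm (f := fun j l => (x j) ^ m * (x l) ^ k * pd j (G l) x)]
    simp only [← Finset.sum_sub_distrib, Finset.mul_sum]
    refine Finset.sum_congr rfl fun j _ => Finset.sum_congr rfl fun l _ => ?_
    by_cases hjl : j = l
    · subst hjl
      ring
    · linear_combination (x j) ^ k * (x l) ^ m * h j l hjl x hx
  push_cast
  linear_combination key
end
end
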